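/- Let λ₀ = inf { ∫((f')² + V·f²) dx : f ∈ H¹(ℝ), ∫f² = 1 } be the bottom of the spectrum of L. Then −(0.883)² ≤ λ₀ ≤ −(0.808)²; equivalently, writing λ₀ = −μ₀² with μ₀ > 0, the first eigenvalue satisfies 0.808 ≤ μ₀ ≤ 0.883. -/

import Mathlib

open Real MeasureTheory Filter

noncomputable def Qs (x : ℝ) : ℝ := (3/2) * (1 / Real.cosh (x/2))^2
noncomputable def Hs (x : ℝ) : ℝ := Real.tanh (x/2)
noncomputable def alphaFn (x : ℝ) : ℝ := (1/3) * (Real.sinh x + x)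
noncomputable def alphaInv : ℝ → ℝ := Function.invFun alphaFn
noncomputable def Qt (x : ℝ) : ℝ := Qs (alphaInv x)
noncomputable def Ht (x : ℝ) : ℝ := Hs (alphaInv x)
noncomputable def Vpot (x : ℝ) : ℝ := 2 * (Qt x)^2 * (1 - Qt x)

/-- The set of values of the quadratic form of `L` over `L²`-normalized `H¹`
functions. -/
def quadFormValues : Set ℝ :=
  {r : ℝ | ∃ f : ℝ → ℝ, Differentiable ℝ f ∧
    Integrable (fun x => (f x)^2) ∧ Integrable (fun x => (deriv f x)^2) ∧
    (∫ x, (f x)^2) = 1 ∧ r = ∫ x, ((deriv f x)^2 + Vpot x * (f x)^2)}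

open scoped Topology

theorem hasDerivAt_alphaFn (y : ℝ) : HasDerivAt alphaFn ((1/3) * (cosh y + 1)) y :=
  ((Real.hasDerivAt_sinh y).add (hasDerivAt_id y)).const_mul (1/3)

theorem continuous_alphaFn : Continuous alphaFn :=
  continuous_iff_continuousAt.2 fun y => (hasDerivAt_alphaFn y).continuousAt

theorem strictMono_alphaFn : StrictMono alphaFn :=
  strictMono_of_deriv_pos fun y => by
    rw [(hasDerivAt_alphaFn y).deriv]
    have := Real.cosh_pos y
    positivity

theorem surjective_alphaFn : Function.Surjective alphaFn := by
  refine continuous_alphaFn.surjective ?_ ?_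
  · refine tendsto_atTop_mono' _ ?_ (tendsto_id.const_mul_atTop (show (0:ℝ) < 1/3 by norm_num))
    filter_upwards [eventually_ge_atTop 0] with y hy
    have := Real.sinh_nonneg_iff.2 hy
    simp only [alphaFn, id]
    linarith
  · refine tendsto_atBot_mono' _ ?_ (tendsto_id.const_mul_atBot (show (0:ℝ) < 1/3 by norm_num))
    filter_upwards [eventually_le_atBot 0] with y hy
    have := Real.sinh_nonpos_iff.2 hy
    simp only [alphaFn, id]
    linarith

noncomputable def alphaIso : ℝ ≃o ℝ :=
  strictMono_alphaFn.orderIsoOfSurjective alphaFn surjective_alphaFn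

theorem alphaFn_alphaInv (x : ℝ) : alphaFn (alphaInv x) = x :=
  Function.rightInverse_invFun surjective_alphaFn x

theorem alphaInv_eq : alphaInv = alphaIso.symm := by
  funext x
  apply alphaIso.injective
  rw [OrderIso.apply_symm_apply]
  exact alphaFn_alphaInv x

theorem hasDerivAt_alphaInv (x : ℝ) :
    HasDerivAt alphaInv ((1/3) * (cosh (alphaInv x) + 1))⁻¹ x := by
  refine HasDerivAt.of_local_left_inverse ?_ (hasDerivAt_alphaFn _) ?_
    (Eventually.of_forall alphaFn_alphaInv)
  · rw [alphaInv_eq]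
    exact alphaIso.symm.continuous.continuousAt
  · have := Real.cosh_pos (alphaInv x)
    positivity

theorem hasDerivAt_tanh_real (y : ℝ) : HasDerivAt Real.tanh (1 - Real.tanh y ^ 2) y := by
  have h := (Real.hasDerivAt_sinh y).div (Real.hasDerivAt_cosh y) (Real.cosh_pos y).ne'
  have e : Real.tanh = Real.sinh / Real.cosh := funext Real.tanh_eq_sinh_div_cosh
  have := (Real.cosh_pos y).ne'
  rw [Real.tanh_eq_sinh_div_cosh, e]
  refine h.congr_deriv ?_
  field_simp

theorem tendsto_tanh_atTop_one : Tendsto Real.tanh atTop (𝓝 1) := by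
  have e : Real.tanh = fun x => (1 - exp (-(2 * x))) / (1 + exp (-(2 * x))) := by
    funext x
    have h : exp (-(2 * x)) = exp (-x) * exp (-x) := by rw [← Real.exp_add]; ring_nf
    have h' : exp x * exp (-x) = 1 := by rw [← Real.exp_add]; simp
    have := Real.exp_pos x
    have := Real.exp_pos (-x)
    rw [Real.tanh_eq_sinh_div_cosh, Real.sinh_eq, Real.cosh_eq, h,
      div_eq_div_iff (by positivity) (by positivity)]
    linear_combination exp (-x) * h'
  rw [e]
  have h : Tendsto (fun x : ℝ => exp (-(2 * x))) atTop (𝓝 0) :=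
    tendsto_exp_neg_atTop_nhds_zero.comp (tendsto_id.const_mul_atTop (by norm_num : (0:ℝ) < 2))
  have h' := (h.const_sub 1).div (h.const_add 1) (by norm_num)
  simp only [sub_zero, add_zero, div_one] at h'
  exact h'

theorem tendsto_tanh_atBot_neg_one : Tendsto Real.tanh atBot (𝓝 (-1)) := by
  simpa [Function.comp_def, Real.tanh_neg] using
    (tendsto_tanh_atTop_one.comp tendsto_neg_atBot_atTop).neg

theorem tendsto_Ht_atTop : Tendsto Ht atTop (𝓝 1) := by
  have h : Tendsto alphaInv atTop atTop := by
    rw [alphaInv_eq]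
    exact alphaIso.symm.tendsto_atTop
  exact tendsto_tanh_atTop_one.comp (h.atTop_div_const (by norm_num : (0:ℝ) < 2))

theorem tendsto_Ht_atBot : Tendsto Ht atBot (𝓝 (-1)) := by
  have h : Tendsto alphaInv atBot atBot := by
    rw [alphaInv_eq]
    exact alphaIso.symm.tendsto_atBot
  exact tendsto_tanh_atBot_neg_one.comp (h.atBot_div_const (by norm_num : (0:ℝ) < 2))

theorem Ht_sq_lt_one (x : ℝ) : Ht x ^ 2 < 1 := Real.tanh_sq_lt_one _

theorem one_sub_tanh_sq (y : ℝ) : 1 - Real.tanh y ^ 2 = (1 / cosh y) ^ 2 := by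
  have := (Real.cosh_pos y).ne'
  rw [Real.tanh_eq_sinh_div_cosh]
  field_simp
  linarith [Real.cosh_sq y]

theorem hasDerivAt_Ht (x : ℝ) : HasDerivAt Ht ((3/4) * (1 - Ht x ^ 2) ^ 2) x := by
  have h := (hasDerivAt_tanh_real (alphaInv x / 2)).comp x ((hasDerivAt_alphaInv x).div_const 2)
  refine h.congr_deriv ?_
  have e := one_sub_tanh_sq (alphaInv x / 2)
  have c : cosh (alphaInv x) + 1 = 2 * cosh (alphaInv x / 2) ^ 2 := by
    have h2 := Real.cosh_two_mul (alphaInv x / 2)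
    rw [show 2 * (alphaInv x / 2) = alphaInv x by ring] at h2
    linarith [Real.cosh_sq (alphaInv x / 2)]
  have := (Real.cosh_pos (alphaInv x / 2)).ne'
  simp only [Ht, Hs]
  rw [e, c]
  field_simp
  norm_num

theorem continuous_Ht : Continuous Ht :=
  continuous_iff_continuousAt.2 fun x => (hasDerivAt_Ht x).continuousAt

theorem Vpot_eq (x : ℝ) :
    Vpot x = (9/4) * (1 - Ht x ^ 2) ^ 2 * (3 * Ht x ^ 2 - 1) := by
  have e := one_sub_tanh_sq (alphaInv x / 2)
  simp only [Vpot, Qt, Qs, Ht, Hs]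
  rw [← e]
  ring

theorem exists_bound_comp_Ht {g : ℝ → ℝ} (hg : Continuous g) : ∃ C, ∀ x, ‖g (Ht x)‖ ≤ C := by
  obtain ⟨C, hC⟩ := (isCompact_Icc (a := (-1:ℝ)) (b := 1)).exists_bound_of_continuousOn
    hg.continuousOn
  exact ⟨C, fun x => hC _ (abs_le.1 (Real.abs_tanh_lt_one _).le)⟩

theorem integrable_comp_Ht_mul {g φ : ℝ → ℝ} (hg : Continuous g) (hφ : Integrable φ) :
    Integrable fun x => g (Ht x) * φ x := by
  obtain ⟨C, hC⟩ := exists_bound_comp_Ht hg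
  exact hφ.bdd_mul (hg.comp continuous_Ht).aestronglyMeasurable (Eventually.of_forall hC)

theorem integrable_deriv_Ht : Integrable fun x => (3/4) * (1 - Ht x ^ 2) ^ 2 := by
  have hp : IntegrableOn (fun x => (3/4) * (1 - Ht x ^ 2) ^ 2) (Set.Ioi 0) :=
    integrableOn_Ioi_deriv_of_nonneg' (fun x _ => hasDerivAt_Ht x)
      (fun x _ => by positivity) tendsto_Ht_atTop
  have hd : ∀ x, HasDerivAt (fun x => - Ht (-x)) ((3/4) * (1 - Ht (-x) ^ 2) ^ 2) x := fun x =>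
    ((hasDerivAt_Ht (-x)).comp x (hasDerivAt_neg x)).neg.congr_deriv (by ring)
  have hn : IntegrableOn (fun x => (3/4) * (1 - Ht (-x) ^ 2) ^ 2) (Set.Ioi 0) :=
    integrableOn_Ioi_deriv_of_nonneg' (fun x _ => hd x)
      (fun x _ => by positivity) (tendsto_Ht_atBot.comp tendsto_neg_atTop_atBot).neg
  rw [← integrableOn_univ, ← Set.Iic_union_Ioi (a := (0:ℝ)), integrableOn_union]
  refine ⟨?_, hp⟩
  rw [integrableOn_Iic_iff_integrableOn_Iio]
  rw [← neg_zero] at hn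
  simpa only [neg_neg] using hn.comp_neg_Iio

/-- Change of variables `t = Ht x`, in the form of the fundamental theorem of calculus. -/
theorem integral_comp_Ht {G g : ℝ → ℝ} (hG : ∀ t, HasDerivAt G (g t) t) (hg : Continuous g) :
    ∫ x, g (Ht x) * ((3/4) * (1 - Ht x ^ 2) ^ 2) = G 1 - G (-1) :=
  integral_of_hasDerivAt_of_tendsto (fun x => (hG (Ht x)).comp x (hasDerivAt_Ht x))
    (integrable_comp_Ht_mul hg integrable_deriv_Ht)
    ((hG _).continuousAt.tendsto.comp tendsto_Ht_atBot)
    ((hG _).continuousAt.tendsto.comp tendsto_Ht_atTop)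

theorem integral_quadForm_ge {f : ℝ → ℝ} (hf : Differentiable ℝ f)
    (h0 : Integrable fun x => f x ^ 2) (h1 : Integrable fun x => deriv f x ^ 2) :
    -(3/4) * ∫ x, f x ^ 2 ≤ ∫ x, (deriv f x ^ 2 + Vpot x * f x ^ 2) := by
  have hV : Integrable fun x => Vpot x * f x ^ 2 := by
    simp only [Vpot_eq]
    exact integrable_comp_Ht_mul (g := fun t => (9/4) * (1 - t ^ 2) ^ 2 * (3 * t ^ 2 - 1))
      (by fun_prop) h0
  have hff : Integrable fun x => f x * deriv f x := by
    refine (h0.add h1).mono'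
      (hf.continuous.measurable.mul (measurable_deriv f)).aestronglyMeasurable
      (Eventually.of_forall fun x => ?_)
    rw [Real.norm_eq_abs, abs_le]
    simp only [Pi.add_apply]
    constructor <;> nlinarith [sq_nonneg (f x + deriv f x), sq_nonneg (f x - deriv f x)]
  set w : ℝ → ℝ := fun t => 2 * t - (3/2) * t ^ 3 with hw
  set w' : ℝ → ℝ := fun t => (2 - (9/2) * t ^ 2) * ((3/4) * (1 - t ^ 2) ^ 2) with hw'
  have hwd : ∀ t, HasDerivAt w (2 - (9/2) * t ^ 2) t := fun t => by
    refine (((hasDerivAt_id t).const_mul 2).sub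
      ((hasDerivAt_pow 3 t).const_mul (3/2))).congr_deriv ?_
    simp only [Nat.reduceSub, Nat.cast_ofNat]
    ring
  have hder : ∀ x, HasDerivAt (fun x => w (Ht x) * f x ^ 2)
      (w' (Ht x) * f x ^ 2 + 2 * w (Ht x) * (f x * deriv f x)) x := fun x => by
    refine (((hwd (Ht x)).comp x (hasDerivAt_Ht x)).mul ((hf x).hasDerivAt.pow 2)).congr_deriv ?_
    simp only [hw', Function.comp, Pi.pow_apply]
    simp only [Nat.reduceSub, Nat.cast_ofNat]
    ring
  have hi : Integrable fun x => w' (Ht x) * f x ^ 2 + 2 * w (Ht x) * (f x * deriv f x) :=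
    (integrable_comp_Ht_mul (g := w') (by fun_prop) h0).add
    (integrable_comp_Ht_mul (g := fun t => 2 * w t) (by fun_prop) hff)
  have hfV : Integrable fun x => deriv f x ^ 2 + Vpot x * f x ^ 2 := h1.add hV
  have hz := integral_eq_zero_of_hasDerivAt_of_integrable hder hi
    (integrable_comp_Ht_mul (g := w) (by fun_prop) h0)
  rw [← integral_const_mul, ← add_zero (∫ x, (deriv f x ^ 2 + Vpot x * f x ^ 2)), ← hz,
    ← integral_add hfV hi]
  refine integral_mono (h0.const_mul _) (hfV.add hi) fun x => ?_
  have key : 0 ≤ 3/4 + Vpot x + w' (Ht x) - w (Ht x) ^ 2 := by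
    rw [Vpot_eq]
    simp only [hw, hw']
    have hs := Ht_sq_lt_one x
    have hs0 := sq_nonneg (Ht x)
    generalize Ht x = t at *
    have e : 3/4 + 9/4 * (1 - t ^ 2) ^ 2 * (3 * t ^ 2 - 1)
        + (2 - 9/2 * t ^ 2) * (3/4 * (1 - t ^ 2) ^ 2) - (2 * t - 3/2 * t ^ 3) ^ 2
        = 3/4 + (1 - t^2) ^ 2 * (9/4 * (3 * t^2 - 1) + 3/4 * (2 - 9/2 * t^2))
          - t^2 * (2 - 3/2 * t^2) ^ 2 := by ring
    rw [e]
    generalize t ^ 2 = s at *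
    nlinarith [mul_nonneg hs0 (sub_nonneg.2 hs.le),
      mul_nonneg hs0 (sq_nonneg (s - 1/2)), mul_nonneg hs0 (sq_nonneg (s - 2/3))]
  have := mul_nonneg key (sq_nonneg (f x))
  dsimp only
  nlinarith [sq_nonneg (deriv f x + w (Ht x) * f x)]

theorem neg_div_mem_quadFormValues : -(152576/135135) / (14656/8505) ∈ quadFormValues := by
  set c : ℝ := √(8505/14656)
  have hc2 : c ^ 2 = 8505/14656 := Real.sq_sqrt (by norm_num)
  set p : ℝ → ℝ := fun t => c * ((1 - t ^ 2) ^ 2 * (1 + (2/3) * t ^ 2)) with hp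
  set p' : ℝ → ℝ := fun t => c * ((1 - t ^ 2) * (-(8/3) * t - 4 * t ^ 3)) with hp'
  have hpd : ∀ t, HasDerivAt p (p' t) t := fun t => by
    refine ((((hasDerivAt_pow 2 t).const_sub 1).pow 2).mul
      (((hasDerivAt_pow 2 t).const_mul (2/3)).const_add 1)).const_mul c |>.congr_deriv ?_
    simp only [hp', Pi.pow_apply]
    simp only [Nat.reduceSub, Nat.cast_ofNat]
    ring
  have hd : ∀ x, HasDerivAt (fun x => p (Ht x)) (p' (Ht x) * ((3/4) * (1 - Ht x ^ 2) ^ 2)) x :=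
    fun x => (hpd (Ht x)).comp x (hasDerivAt_Ht x)
  have hderiv : deriv (fun x => p (Ht x)) = fun x => p' (Ht x) * ((3/4) * (1 - Ht x ^ 2) ^ 2) :=
    funext fun x => (hd x).deriv
  set m : ℝ → ℝ := fun t => c ^ 2 * ((4/3) * ((1 - t ^ 2) * (1 + (2/3) * t ^ 2)) ^ 2) with hm
  have hsq : (fun x => p (Ht x) ^ 2) = fun x => m (Ht x) * ((3/4) * (1 - Ht x ^ 2) ^ 2) := by
    funext x
    simp only [hp, hm]
    ring
  refine ⟨fun x => p (Ht x), fun x => (hd x).differentiableAt, ?_, ?_, ?_, ?_⟩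
  · rw [hsq]
    exact integrable_comp_Ht_mul (by fun_prop) integrable_deriv_Ht
  · rw [hderiv]
    have h := integrable_comp_Ht_mul (g := fun t => p' t ^ 2 * ((3/4) * (1 - t ^ 2) ^ 2))
      (by fun_prop) integrable_deriv_Ht
    refine h.congr (Eventually.of_forall fun x => ?_)
    ring
  · rw [hsq, integral_comp_Ht (G := fun t => c ^ 2 * (4/3 * t - 8/27 * t ^ 3 - 44/135 * t ^ 5
      + 16/189 * t ^ 7 + 16/243 * t ^ 9)) _ (by fun_prop)]
    · rw [hc2]
      norm_num
    · intro t
      refine (((((((hasDerivAt_id t).const_mul (4/3)).sub ((hasDerivAt_pow 3 t).const_mul _)).sub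
        ((hasDerivAt_pow 5 t).const_mul _)).add ((hasDerivAt_pow 7 t).const_mul _)).add
        ((hasDerivAt_pow 9 t).const_mul _)).const_mul (c ^ 2)).congr_deriv ?_
      simp only [hm]
      simp only [Nat.reduceSub, Nat.cast_ofNat]
      ring
  · set E : ℝ → ℝ := fun t => p' t ^ 2 * ((3/4) * (1 - t ^ 2) ^ 2) + (9 * t ^ 2 - 3) * p t ^ 2
      with hE
    have hen : (fun x => deriv (fun x => p (Ht x)) x ^ 2 + Vpot x * p (Ht x) ^ 2)
        = fun x => E (Ht x) * ((3/4) * (1 - Ht x ^ 2) ^ 2) := by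
      funext x
      simp only [hderiv, Vpot_eq, hE]
      ring
    rw [hen, integral_comp_Ht (G := fun t => c ^ 2 * (-3 * t + 67/9 * t ^ 3 - 98/15 * t ^ 5
      - 50/21 * t ^ 7 + 155/27 * t ^ 9 - 1/33 * t ^ 11 - 112/39 * t ^ 13 + 16/15 * t ^ 15)) _
      (by fun_prop)]
    · rw [hc2]
      norm_num
    · intro t
      refine ((((((((((hasDerivAt_id t).const_mul (-3)).add
        ((hasDerivAt_pow 3 t).const_mul _)).sub
        ((hasDerivAt_pow 5 t).const_mul _)).sub ((hasDerivAt_pow 7 t).const_mul _)).add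
        ((hasDerivAt_pow 9 t).const_mul _)).sub ((hasDerivAt_pow 11 t).const_mul _)).sub
        ((hasDerivAt_pow 13 t).const_mul _)).add
        ((hasDerivAt_pow 15 t).const_mul _)).const_mul (c ^ 2)).congr_deriv ?_
      simp only [hE, hp, hp']
      simp only [Nat.reduceSub, Nat.cast_ofNat]
      ring

/-- Two-sided bound for the bottom of the spectrum of `L`. -/
theorem ground_state_energy_bounds :
    -(0.883:ℝ)^2 ≤ sInf quadFormValues ∧ sInf quadFormValues ≤ -(0.808:ℝ)^2 := by
  have hlb : ∀ r ∈ quadFormValues, -(0.883:ℝ)^2 ≤ r := by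
    rintro r ⟨f, hf, h0, h1, hn, rfl⟩
    have h := integral_quadForm_ge hf h0 h1
    rw [hn] at h
    norm_num at h ⊢
    linarith
  refine ⟨le_csInf ⟨_, neg_div_mem_quadFormValues⟩ hlb, ?_⟩
  exact (csInf_le ⟨_, hlb⟩ neg_div_mem_quadFormValues).trans (by norm_num)
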